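/- arXiv:2504.21057 — 2 statements merged into one kernel-verified Lean document; each statement's English description precedes it below -/
import Mathlib

section
/- Let f : S → ℂ satisfy the integral Kannappan multiplicative equation ∫_S f(xσ(y)t) dμ(t) = f(x) f(y) for all x, y ∈ S. Then there exists a multiplicative function χ : S → ℂ with χ∘σ = χ such that f = (∫_S χ(t) dμ(t)) · χ. -/
/-- Integral of `h` against a finitely supported complex measure `μ` on `S`:
`∫_S h(t) dμ(t) = Σ_t μ(t) h(t)`. -/
noncomputable def mint {S : Type*} (μ : S →₀ ℂ) (h : S → ℂ) : ℂ :=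
  μ.sum fun t c => c * h t

lemma mint_const_mul {S : Type*} (μ : S →₀ ℂ) (c : ℂ) (h : S → ℂ) :
    mint μ (fun t => c * h t) = c * mint μ h := by
  simp only [mint, Finsupp.sum, Finset.mul_sum]
  exact Finset.sum_congr rfl fun t _ => by ring

theorem stmt_1 {S : Type*} [Semigroup S] (σ : S → S)
    (hσmul : ∀ x y : S, σ (x * y) = σ x * σ y) (hσinv : ∀ x : S, σ (σ x) = x)
    (μ : S →₀ ℂ) (f : S → ℂ)
    (hf : ∀ x y : S, mint μ (fun t => f (x * σ y * t)) = f x * f y) :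
    ∃ χ : S → ℂ, (∀ x y : S, χ (x * y) = χ x * χ y) ∧ (∀ x : S, χ (σ x) = χ x) ∧
      f = fun x => mint μ χ * χ x := by
  by_cases h0 : ∀ x, f x = 0
  · exact ⟨fun _ => 0, by simp, by simp, by funext x; simp [h0 x]⟩
  push Not at h0
  obtain ⟨a, ha⟩ := h0
  have hL (x y : S) : mint μ (fun t => f (x * y * t)) = f x * f (σ y) := by
    simpa only [hσinv] using hf x (σ y)
  have hassoc (x y z : S) : f (x * y) * f (σ z) = f x * f (σ (y * z)) := by
    rw [← hL, ← hL, mul_assoc x y z]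
  obtain ⟨φ, hφ⟩ : ∃ φ : S → ℂ, ∀ x y, f (x * y) = f x * φ y := by
    refine ⟨fun y => f (σ (y * σ a)) / f a, fun x y => ?_⟩
    have h := hassoc x y (σ a)
    rw [hσinv] at h
    field_simp
    exact h
  have hmul (y z : S) : φ (y * z) = φ y * φ z := by
    apply mul_left_cancel₀ ha
    rw [← hφ, ← mul_assoc, hφ, hφ, mul_assoc]
  have hleft (y z : S) : f y * φ z = φ (σ y) * f z := by
    have h := hassoc a (σ y) (σ z)
    rw [← hσmul, hσinv, hσinv, hφ a, hφ y, mul_assoc] at h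
    exact (mul_left_cancel₀ ha h).symm
  obtain ⟨b, hb⟩ : ∃ b, φ b ≠ 0 := by
    by_contra! h
    have h1 := hf a a
    simp only [hφ, h, mul_zero] at h1
    simp [mint, ha] at h1
  obtain ⟨c, hc⟩ : ∃ c, ∀ y, f y = c * φ (σ y) := by
    refine ⟨f b / φ b, fun y => ?_⟩
    have h := hleft y b
    field_simp
    linear_combination h
  have hne : c ≠ 0 ∧ φ (σ a) ≠ 0 := by
    rw [hc] at ha
    exact mul_ne_zero_iff.mp ha
  have hσ (x : S) : φ (σ x) = φ x := by
    have h := hleft a x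
    rw [hc, hc] at h
    apply mul_left_cancel₀ (mul_ne_zero hne.1 hne.2)
    linear_combination -h
  refine ⟨φ, hmul, hσ, ?_⟩
  have hcφ (x : S) : f x = c * φ x := by rw [hc, hσ]
  have h := hf a a
  simp only [hφ, hσ] at h
  rw [mint_const_mul, hcφ] at h
  have hm : mint μ φ = c := by
    have hn := mul_ne_zero hne.1 (mul_ne_zero hne.2 hne.2)
    rw [hσ] at hn
    apply mul_left_cancel₀ hn
    linear_combination h
  funext x
  rw [hm, hcφ]
end

section
/- Let f, g : S → ℂ satisfy the integral Kannappan-sine subtraction law ∫_S f(xσ(y)t) dμ(t) = f(x)g(y) − f(y)g(x) for all x, y ∈ S, and suppose f and g are linearly independent over ℂ. Then ∫_S g(s) dμ(s) ≠ 0. -/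
theorem mint_linear_comb {S : Type*} (μ : S →₀ ℂ) (a b : ℂ) (h k : S → ℂ) :
    mint μ (fun t => a * h t + b * k t) = a * mint μ h + b * mint μ k := by
  simp only [mint, Finsupp.sum, Finset.mul_sum, ← Finset.sum_add_distrib]
  exact Finset.sum_congr rfl fun t _ => by ring

/-- If two functions satisfy no nontrivial linear relation, then some `2 × 2` minor of their
values is nonzero. -/
theorem exists_minor_ne_zero {S : Type*} {f g : S → ℂ}
    (hli : ∀ a b : ℂ, (∀ x : S, a * f x + b * g x = 0) → a = 0 ∧ b = 0) :
    ∃ x y : S, f x * g y - f y * g x ≠ 0 := by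
  by_contra! h
  have hzero : ∀ y, f y = 0 ∧ g y = 0 := fun y => by
    have := hli (g y) (-f y) fun x => by linear_combination h x y
    exact ⟨neg_eq_zero.mp this.2, this.1⟩
  exact one_ne_zero (hli 1 1 fun x => by simp [hzero x]).1

/-- Under the integral Kannappan-sine subtraction law, the span of `f` and `g` is invariant under
right translations. -/
theorem exists_right_translation_coeff {S : Type*} [Semigroup S] {σ : S → S}
    (hσmul : ∀ x y : S, σ (x * y) = σ x * σ y) (hσinv : ∀ x : S, σ (σ x) = x)
    {μ : S →₀ ℂ} {f g : S → ℂ}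
    (hf : ∀ x y : S, mint μ (fun t => f (x * σ y * t)) = f x * g y - f y * g x)
    (hli : ∀ a b : ℂ, (∀ x : S, a * f x + b * g x = 0) → a = 0 ∧ b = 0) :
    ∃ a b c d : S → ℂ, (∀ x y, f (x * y) = f x * a y + g x * c y) ∧
      (∀ x y, g (x * y) = f x * b y + g x * d y) := by
  obtain ⟨u, v, huv⟩ := exists_minor_ne_zero hli
  have key : ∀ x y z, f (x * y) * g z - f z * g (x * y)
      = f x * g (σ y * z) - f (σ y * z) * g x := fun x y z => by
    rw [← hf, ← hf, hσmul, hσinv]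
    simp only [mul_assoc]
  obtain ⟨e, he⟩ : ∃ e, e * (f u * g v - f v * g u) = 1 := ⟨_, inv_mul_cancel₀ huv⟩
  refine ⟨fun y => e * (f u * g (σ y * v) - f v * g (σ y * u)),
    fun y => e * (g u * g (σ y * v) - g v * g (σ y * u)),
    fun y => -e * (f u * f (σ y * v) - f v * f (σ y * u)),
    fun y => -e * (g u * f (σ y * v) - g v * f (σ y * u)), fun x y => ?_, fun x y => ?_⟩
  · linear_combination e * f u * key x y v - e * f v * key x y u - f (x * y) * he
  · linear_combination e * g u * key x y v - e * g v * key x y u - g (x * y) * he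

theorem stmt_5 {S : Type*} [Semigroup S] (σ : S → S)
    (hσmul : ∀ x y : S, σ (x * y) = σ x * σ y) (hσinv : ∀ x : S, σ (σ x) = x)
    (μ : S →₀ ℂ) (f g : S → ℂ)
    (hf : ∀ x y : S, mint μ (fun t => f (x * σ y * t)) = f x * g y - f y * g x)
    (hli : ∀ a b : ℂ, (∀ x : S, a * f x + b * g x = 0) → a = 0 ∧ b = 0) :
    mint μ g ≠ 0 := by
  intro hw
  obtain ⟨u, v, huv⟩ := exists_minor_ne_zero hli
  obtain ⟨a, b, c, d, hfm, hgm⟩ := exists_right_translation_coeff hσmul hσinv hf hli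
  -- left translations act through the adjugate of `!![a, b; c, d]`
  have hleft : ∀ y z, f (y * z) = f z * d (σ y) - g z * c (σ y) ∧
      g (y * z) = -(f z * b (σ y)) + g z * a (σ y) := fun y z => by
    have key : ∀ x, f (x * σ y) * g z - f z * g (x * σ y)
        = f x * g (y * z) - f (y * z) * g x := fun x => by
      rw [← hf, ← hf, hσmul]
      simp only [mul_assoc]
    have := hli (g (y * z) + f z * b (σ y) - g z * a (σ y))
      (-f (y * z) + f z * d (σ y) - g z * c (σ y)) fun x => by
        have h := key x
        rw [hfm, hgm] at h
        linear_combination -h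
    exact ⟨by linear_combination -this.2, by linear_combination this.1⟩
  set F : S → ℂ := fun x => mint μ fun t => f (x * t) with hFdef
  have hFD : ∀ x y, F (x * σ y) = f x * g y - f y * g x := hf
  have hFD' : ∀ x y, F (x * y) = f x * g (σ y) - f (σ y) * g x := fun x y => by
    rw [← hFD, hσinv]
  obtain ⟨p, hp⟩ : ∃ p, p = mint μ a := ⟨_, rfl⟩
  obtain ⟨q, hq⟩ : ∃ q, q = mint μ c := ⟨_, rfl⟩
  obtain ⟨w, hwf⟩ : ∃ w, w = mint μ f := ⟨_, rfl⟩
  have hF : ∀ x, F x = p * f x + q * g x := fun x => by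
    simp only [hFdef, hfm, mint_linear_comb, hp, hq]
    ring
  have hFd : ∀ x, F x = w * d (σ x) := fun x => by
    have : F x = mint μ fun t => d (σ x) * f t + (-c (σ x)) * g t := by
      simp only [hFdef]
      congr 1
      funext t
      rw [(hleft x t).1]
      ring
    rw [this, mint_linear_comb, hw, ← hwf]
    ring
  have hF0 : ¬ ∀ x, F x = 0 := fun h => huv (by rw [← hFD, h])
  have hw0 : w ≠ 0 := fun h => hF0 fun x => by rw [hFd, h, zero_mul]
  have htr : ∀ y z, (a (σ y) + d (σ y)) * F z = F (z * σ y) + F (y * z) := fun y z => by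
    rw [hF (z * σ y), hF (y * z), hfm, hgm, (hleft y z).1, (hleft y z).2, hF]
    ring
  have hodd : ∀ z, F (σ z) = -F z := by
    by_contra! hne
    obtain ⟨z₀, hz₀⟩ := hne
    have htr0 : ∀ y, a (σ y) + d (σ y) = 0 := fun y => by
      have h : (a (σ y) + d (σ y)) * (F (σ z₀) + F z₀) = 0 := by
        rw [mul_add, htr, htr, hFD, hFD, hFD, hFD']
        ring
      exact (mul_eq_zero.mp h).resolve_right fun h' => hz₀ (eq_neg_of_add_eq_zero_left h')
    have heven : ∀ z, f (σ z) = f z ∧ g (σ z) = g z := fun z => by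
      have := hli (-(g z - g (σ z))) (f z - f (σ z)) fun y => by
        have h := htr y z
        rw [htr0, hFD, hFD'] at h
        linear_combination -h
      exact ⟨by linear_combination -this.2, by linear_combination this.1⟩
    have hanti : ∀ y z, f (y * z) = -f (z * y) := fun y z => by
      have h1 : f (z * σ y) = f (z * y) := by
        rw [← (heven (z * σ y)).1, hσmul, hσinv, hfm, hfm, (heven z).1, (heven z).2]
      rw [(hleft y z).1, ← h1, hfm]
      linear_combination f z * htr0 y
    have hf3 : ∀ x y z, f (x * y * z) = 0 := fun x y z => by
      have h1 := hanti x (y * z)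
      have h2 := hanti y (z * x)
      have h3 := hanti z (x * y)
      simp only [← mul_assoc] at h1 h2 h3
      linear_combination (h1 - h2 + h3) / 2
    exact huv (by rw [← hf]; simp [hf3, mint])
  have hcomm : ∀ x y, F (x * y) = F (y * x) := fun x y => by
    have h := hodd (y * x)
    rw [hσmul, hFD] at h
    rw [hFD']
    linear_combination -h
  obtain ⟨r, hr⟩ : ∃ r, r = mint μ b := ⟨_, rfl⟩
  have hintF : mint μ F = p * w := by
    rw [funext hF, mint_linear_comb, hw, ← hwf]
    ring
  have hd : ∀ x, d x = -(1 / w) * F x + 0 * F x := fun x => by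
    have h := hFd (σ x)
    rw [hσinv, hodd] at h
    field_simp
    linear_combination -h
  have hintd : mint μ d = -p := by
    rw [funext hd, mint_linear_comb, hintF]
    field_simp
    ring
  have hintg : ∀ x, mint μ (fun t => g (x * t)) = f x * r - g x * p := fun x => by
    rw [funext (hgm x), mint_linear_comb, hintd, ← hr]
    ring
  obtain ⟨L, hL⟩ : ∃ L, L = p ^ 2 + q * r := ⟨_, rfl⟩
  have hintFx : ∀ x, mint μ (fun t => F (x * t)) = L * f x := fun x => by
    rw [funext fun t => hF (x * t), mint_linear_comb, hintg,
      show mint μ (fun t => f (x * t)) = F x from rfl, hF, hL]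
    ring
  have hL0 : L ≠ 0 := by
    intro h0
    refine hF0 fun x => (hli (-mint μ fun t => g (x * t)) (F x) fun y => ?_).2
    have h := hintFx (σ y * x)
    have h' : ∀ t, F (σ y * x * t) = g y * f (x * t) + -f y * g (x * t) := fun t => by
      rw [mul_assoc, hcomm, hFD]
      ring
    rw [funext h', mint_linear_comb, h0, show mint μ (fun t => f (x * t)) = F x from rfl] at h
    linear_combination h
  obtain ⟨τ, hτ, hintτ⟩ : ∃ τ : S → ℂ, (∀ y, τ y = a y + d y) ∧ mint μ τ = 0 := by
    refine ⟨fun t => 1 * a t + 1 * d t, fun y => by ring, ?_⟩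
    rw [mint_linear_comb, hintd, ← hp]
    ring
  simp only [← hτ] at htr
  have hfeven : ∀ z, f (σ z) = f z := fun z => by
    have h : ∀ t, 1 * F (z * t) + -1 * F (σ z * t)
        = F z * τ t + 0 * F t := fun t => by
      have h1 := htr (σ t) z
      have h2 := hodd (σ z * t)
      rw [hσmul, hσinv, hcomm] at h2
      rw [hσinv] at h1
      linear_combination -h2 - h1
    have h' := congrArg (mint μ) (funext h)
    rw [mint_linear_comb, mint_linear_comb, hintτ, hintFx, hintFx] at h'
    refine mul_left_cancel₀ hL0 ?_
    linear_combination -h'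
  have htrf : ∀ y, τ y * (p * w) = 2 * L * f y := fun y => by
    have h : ∀ t, τ y * F t + 0 * F t = 1 * F (y * t) + 1 * F (σ y * t) := fun t => by
      have h1 := htr (σ y) t
      rw [hσinv, hcomm t] at h1
      linear_combination h1
    have h' := congrArg (mint μ) (funext h)
    rw [mint_linear_comb, mint_linear_comb, hintF, hintFx, hintFx, hfeven] at h'
    linear_combination h'
  have h : ∀ y, p * w * τ y + 0 * f y = 2 * L * f y + 0 * f y := fun y => by
    linear_combination htrf y
  have h' := congrArg (mint μ) (funext h)
  rw [mint_linear_comb, mint_linear_comb, hintτ, ← hwf] at h'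
  exact mul_ne_zero (mul_ne_zero two_ne_zero hL0) hw0 (by linear_combination -h')
end
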